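/- Let q ∈ [2,∞) and let h : ℝ^d → ℝ be a C¹ function with ∫_{ℝ^d} |h|^q dμ < ∞ that satisfies the weak resolvent identity. Then for every compactly supported Lipschitz function w : ℝ^d → ℝ one has ∫_{ℝ^d} w² |h|^q dμ ≤ (2/(q−1)) ∫_{ℝ^d} ⟨A∇w, ∇w⟩ |h|^q dμ + (2/(q−1)) ∫_{ℝ^d} d² |C|_∞² Φ_A⁻¹ ‖∇w‖² |h|^q dμ + (2/q) ∫_{ℝ^d} |⟨B̄, ∇w⟩| |w| |h|^q dμ, the inequality being understood in [0,∞]. -/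

import Mathlib

open MeasureTheory Real
open scoped RealInnerProductSpace ENNReal

noncomputable section

/-- `⟨M v, w⟩` for a `d × d` matrix `M` and vectors `v, w ∈ ℝ^d`. -/
def mdot {d : ℕ} (M : Matrix (Fin d) (Fin d) ℝ) (v w : EuclideanSpace ℝ (Fin d)) : ℝ :=
  ∑ i, ∑ j, M i j * v j * w i

/-- `|M|_∞ = max_{i,j} |m_ij|`. -/
def matSup {d : ℕ} (M : Matrix (Fin d) (Fin d) ℝ) : ℝ :=
  ⨆ i, ⨆ j, |M i j|

/-- `Φ_M = inf_{ξ ≠ 0} ⟨M ξ, ξ⟩ / ‖ξ‖²`. -/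
def PhiA {d : ℕ} (M : Matrix (Fin d) (Fin d) ℝ) : ℝ :=
  ⨅ ξ : {ξ : EuclideanSpace ℝ (Fin d) // ξ ≠ 0}, mdot M ξ.1 ξ.1 / ‖ξ.1‖ ^ 2

/-- `h` satisfies the weak resolvent identity:
`(1/2)∫ ⟨(A+C)∇u, ∇h⟩ dμ + ∫ ⟨B̄, ∇u⟩ h dμ + ∫ u h dμ = 0` for every compactly supported
Lipschitz `u`. -/
def WeakResolvent {d : ℕ} (μ : Measure (EuclideanSpace ℝ (Fin d)))
    (A C : EuclideanSpace ℝ (Fin d) → Matrix (Fin d) (Fin d) ℝ)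
    (Bb : EuclideanSpace ℝ (Fin d) → EuclideanSpace ℝ (Fin d))
    (h : EuclideanSpace ℝ (Fin d) → ℝ) : Prop :=
  ∀ u : EuclideanSpace ℝ (Fin d) → ℝ,
    (∃ K, LipschitzWith K u) → HasCompactSupport u →
    (1/2) * (∫ x, mdot (A x + C x) (gradient u x) (gradient h x) ∂μ)
      + (∫ x, ⟪Bb x, gradient u x⟫ * h x ∂μ)
      + (∫ x, u x * h x ∂μ) = 0



section MatrixForms

variable {d : ℕ} (M : Matrix (Fin d) (Fin d) ℝ) (v v' w w' : EuclideanSpace ℝ (Fin d))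

theorem mdot_add_left : mdot M (v + v') w = mdot M v w + mdot M v' w := by
  simp [mdot, mul_add, add_mul, Finset.sum_add_distrib]

theorem mdot_add_right : mdot M v (w + w') = mdot M v w + mdot M v w' := by
  simp [mdot, mul_add, Finset.sum_add_distrib]

theorem mdot_smul_left (a : ℝ) : mdot M (a • v) w = a * mdot M v w := by
  simp only [mdot, PiLp.smul_apply, smul_eq_mul, Finset.mul_sum]
  exact Finset.sum_congr rfl fun i _ => Finset.sum_congr rfl fun j _ => by ring

theorem mdot_smul_right (a : ℝ) : mdot M v (a • w) = a * mdot M v w := by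
  simp only [mdot, PiLp.smul_apply, smul_eq_mul, Finset.mul_sum]
  exact Finset.sum_congr rfl fun i _ => Finset.sum_congr rfl fun j _ => by ring

theorem mdot_matrix_add (N : Matrix (Fin d) (Fin d) ℝ) :
    mdot (M + N) v w = mdot M v w + mdot N v w := by
  simp [mdot, add_mul, Finset.sum_add_distrib]

theorem mdot_matrix_neg : mdot (-M) v w = -mdot M v w := by
  simp [mdot]

theorem mdot_transpose : mdot M.transpose v w = mdot M w v := by
  rw [mdot, mdot, Finset.sum_comm]
  exact Finset.sum_congr rfl fun i _ => Finset.sum_congr rfl fun j _ => by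
    rw [Matrix.transpose_apply]; ring

theorem mdot_eq_inner :
    mdot M v w = ⟪WithLp.toLp 2 (M.transpose.mulVec w.ofLp), v⟫ := by
  rw [mdot, Finset.sum_comm, PiLp.inner_apply]
  refine Finset.sum_congr rfl fun j _ => ?_
  simp only [Matrix.mulVec, dotProduct, Matrix.transpose_apply, RCLike.inner_apply, conj_trivial,
    Finset.mul_sum]
  exact Finset.sum_congr rfl fun i _ => by ring

theorem mdot_eq_dotProduct : mdot M v v = v.ofLp ⬝ᵥ M.mulVec v.ofLp := by
  simp only [mdot, dotProduct, Matrix.mulVec, Finset.mul_sum]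
  exact Finset.sum_congr rfl fun i _ => Finset.sum_congr rfl fun j _ => by ring

variable {M v}

theorem mdot_self_pos (hM : M.PosDef) (hv : v ≠ 0) : 0 < mdot M v v := by
  rw [mdot_eq_dotProduct]
  have := hM.dotProduct_mulVec_pos (x := v.ofLp) (by simpa using hv)
  simpa using this

theorem mdot_self_nonneg (hM : M.PosDef) : 0 ≤ mdot M v v := by
  rcases eq_or_ne v 0 with rfl | hv
  · simp [mdot]
  · exact (mdot_self_pos hM hv).le

theorem mdot_self_eq_zero_of_antisymm (hM : M.transpose = -M) : mdot M v v = 0 := by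
  have := mdot_transpose M v v
  rw [hM, mdot_matrix_neg] at this
  linarith

theorem PhiA_mul_le (hM : M.PosDef) : PhiA M * ‖v‖ ^ 2 ≤ mdot M v v := by
  rcases eq_or_ne v 0 with rfl | hv
  · simp [mdot]
  · rw [← le_div_iff₀ (by positivity)]
    refine ciInf_le (f := fun ξ : {ξ : EuclideanSpace ℝ (Fin d) // ξ ≠ 0} =>
      mdot M ξ.1 ξ.1 / ‖ξ.1‖ ^ 2) ⟨0, ?_⟩ ⟨v, hv⟩
    rintro _ ⟨ξ, rfl⟩
    have := mdot_self_nonneg (v := ξ.1) hM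
    positivity

theorem PhiA_pos (hd : 0 < d) (hM : M.PosDef) : 0 < PhiA M := by
  have : Nonempty (Fin d) := ⟨⟨0, hd⟩⟩
  obtain ⟨e, he⟩ := exists_ne (0 : EuclideanSpace ℝ (Fin d))
  have hcont : Continuous fun ξ : EuclideanSpace ℝ (Fin d) => mdot M ξ ξ := by
    unfold mdot; fun_prop
  obtain ⟨ξ₀, hξ₀, hmin⟩ :=
    (isCompact_sphere (0 : EuclideanSpace ℝ (Fin d)) 1).exists_isMinOn
      (NormedSpace.sphere_nonempty.2 zero_le_one) hcont.continuousOn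
  have hξ₀' : ξ₀ ≠ 0 := by rintro rfl; simp at hξ₀
  have : Nonempty {ξ : EuclideanSpace ℝ (Fin d) // ξ ≠ 0} := ⟨⟨e, he⟩⟩
  refine (mdot_self_pos hM hξ₀').trans_le (le_ciInf fun ξ => ?_)
  have hξ : 0 < ‖ξ.1‖ := norm_pos_iff.2 ξ.2
  have hmem : ‖ξ.1‖⁻¹ • ξ.1 ∈ Metric.sphere (0 : EuclideanSpace ℝ (Fin d)) 1 := by
    simp [norm_smul, hξ.ne']
  have := hmin hmem
  simp only [Set.mem_ofPred_eq, mdot_smul_left, mdot_smul_right] at this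
  refine this.trans_eq ?_
  field_simp

theorem abs_le_matSup (i j : Fin d) : |M i j| ≤ matSup M :=
  (le_ciSup (f := fun j => |M i j|) (Set.finite_range _).bddAbove j).trans
    (le_ciSup (f := fun i => ⨆ j, |M i j|) (Set.finite_range _).bddAbove i)

theorem matSup_nonneg : 0 ≤ matSup M :=
  Real.iSup_nonneg fun _ => Real.iSup_nonneg fun _ => abs_nonneg _

theorem sum_abs_le_sqrt_mul_norm (v : EuclideanSpace ℝ (Fin d)) :
    ∑ i, |v i| ≤ √d * ‖v‖ := by
  rw [EuclideanSpace.norm_eq, ← Real.sqrt_mul (Nat.cast_nonneg d)]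
  refine Real.le_sqrt_of_sq_le ?_
  simpa using sq_sum_le_card_mul_sum_sq (s := Finset.univ) (f := fun i => |v i|)

theorem abs_mdot_le : |mdot M v w| ≤ d * matSup M * ‖v‖ * ‖w‖ := by
  calc |mdot M v w| ≤ ∑ i, ∑ j, matSup M * |v j| * |w i| := by
        refine (Finset.abs_sum_le_sum_abs _ _).trans (Finset.sum_le_sum fun i _ => ?_)
        refine (Finset.abs_sum_le_sum_abs _ _).trans (Finset.sum_le_sum fun j _ => ?_)
        rw [abs_mul, abs_mul]
        gcongr
        exact abs_le_matSup i j
    _ = matSup M * ((∑ j, |v j|) * ∑ i, |w i|) := by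
        simp only [← Finset.sum_mul, ← Finset.mul_sum]
        ring
    _ ≤ matSup M * ((√d * ‖v‖) * (√d * ‖w‖)) := by
        have := matSup_nonneg (M := M)
        gcongr <;> exact sum_abs_le_sqrt_mul_norm _
    _ = d * matSup M * ‖v‖ * ‖w‖ := by
        rw [mul_mul_mul_comm, Real.mul_self_sqrt (Nat.cast_nonneg d)]
        ring

/-- The pointwise Young inequality for the symmetric part. -/
theorem neg_mul_mdot_le_of_posDef (hs : M.IsSymm) (hM : M.PosDef) {c : ℝ} (hc : 0 < c) (a b : ℝ) :
    -(a * b * mdot M v w) ≤ c / 4 * (a ^ 2 * mdot M w w) + 1 / c * (b ^ 2 * mdot M v v) := by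
  have key := mdot_self_nonneg (v := (c / 2 * a) • w + b • v) hM
  have hsymm : mdot M w v = mdot M v w := by rw [← mdot_transpose, hs.eq]
  simp only [mdot_add_left, mdot_add_right, mdot_smul_left, mdot_smul_right, hsymm] at key
  have := div_nonneg key hc.le
  have e : (c / 2 * a * (c / 2 * a * mdot M w w + b * mdot M v w) +
      b * (c / 2 * a * mdot M v w + b * mdot M v v)) / c =
      c / 4 * (a ^ 2 * mdot M w w) + 1 / c * (b ^ 2 * mdot M v v) + a * b * mdot M v w := by
    field_simp
    ring
  linarith

/-- The pointwise Young inequality for the antisymmetric part. -/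
theorem neg_mul_mdot_le (hd : 0 < d) (hM : M.PosDef) (N : Matrix (Fin d) (Fin d) ℝ)
    {c : ℝ} (hc : 0 < c) (a b : ℝ) :
    -(a * b * mdot N v w) ≤ c / 4 * (a ^ 2 * mdot M w w) +
      1 / c * (b ^ 2 * ((d : ℝ) ^ 2 * matSup N ^ 2 * (PhiA M)⁻¹ * ‖v‖ ^ 2)) := by
  have hΦ := PhiA_pos hd hM
  have h1 : -(a * b * mdot N v w) ≤ |a| * |b| * (d * matSup N * ‖v‖ * ‖w‖) := by
    refine (neg_le_abs _).trans ?_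
    rw [abs_mul, abs_mul]
    gcongr
    exact abs_mdot_le w
  have h2 : c / 4 * (a ^ 2 * (PhiA M * ‖w‖ ^ 2)) ≤ c / 4 * (a ^ 2 * mdot M w w) := by
    gcongr
    exact PhiA_mul_le hM
  have h3 : 0 ≤ (c / 2 * PhiA M * (|a| * ‖w‖) - |b| * (d * matSup N * ‖v‖)) ^ 2 / (c * PhiA M) := by
    positivity
  have e : (c / 2 * PhiA M * (|a| * ‖w‖) - |b| * (d * matSup N * ‖v‖)) ^ 2 / (c * PhiA M) =
      c / 4 * (|a| ^ 2 * (PhiA M * ‖w‖ ^ 2)) +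
        1 / c * (|b| ^ 2 * ((d : ℝ) ^ 2 * matSup N ^ 2 * (PhiA M)⁻¹ * ‖v‖ ^ 2)) -
        |a| * |b| * (d * matSup N * ‖v‖ * ‖w‖) := by
    field_simp
    ring
  rw [sq_abs, sq_abs] at e
  linarith

end MatrixForms

section Lipschitz

variable {E : Type*} [NormedAddCommGroup E]

theorem exists_lipschitzWith_mul {f g : E → ℝ} (hf : ∃ K, LipschitzWith K f)
    (hfs : HasCompactSupport f) (hg : ∃ K, LipschitzWith K g) (hgs : HasCompactSupport g) :
    ∃ K, LipschitzWith K fun x => f x * g x := by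
  obtain ⟨K, hK⟩ := hf
  obtain ⟨L, hL⟩ := hg
  obtain ⟨a, ha⟩ := hfs.exists_bound_of_continuous hK.continuous
  obtain ⟨b, hb⟩ := hgs.exists_bound_of_continuous hL.continuous
  refine ⟨_, LipschitzWith.of_dist_le' (K := a * L + b * K) fun x y => ?_⟩
  have h1 := hK.dist_le_mul x y
  have h2 := hL.dist_le_mul x y
  rw [Real.dist_eq] at h1 h2 ⊢
  have ha0 := (norm_nonneg _).trans (ha x)
  have hb0 := (norm_nonneg _).trans (hb y)
  calc |f x * g x - f y * g y| = |f x * (g x - g y) + g y * (f x - f y)| := by ring_nf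
    _ ≤ ‖f x‖ * |g x - g y| + ‖g y‖ * |f x - f y| := by
        simpa only [abs_mul, Real.norm_eq_abs] using abs_add_le (f x * (g x - g y)) (g y * (f x - f y))
    _ ≤ a * (L * dist x y) + b * (K * dist x y) := by
        gcongr
        exacts [ha x, hb y]
    _ = (a * L + b * K) * dist x y := by ring

theorem exists_lipschitzWith_mul_contDiff [InnerProductSpace ℝ E] [FiniteDimensional ℝ E]
    {f k : E → ℝ}
    (hf : ∃ K, LipschitzWith K f) (hfs : HasCompactSupport f) (hk : ContDiff ℝ 1 k) :
    ∃ K, LipschitzWith K fun x => f x * k x := by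
  obtain ⟨R, hR, hsub⟩ := hfs.isCompact.isBounded.subset_closedBall_lt 0 0
  let χ : ContDiffBump (0 : E) := ⟨R, R + 1, hR, by linarith⟩
  have hχs : HasCompactSupport fun x => χ x * k x := χ.hasCompactSupport.mul_right
  have := exists_lipschitzWith_mul hf hfs
    ((χ.contDiff.mul hk).lipschitzWith_of_hasCompactSupport hχs one_ne_zero) hχs
  convert this using 4 with K x
  by_cases hx : x ∈ tsupport f
  · rw [χ.one_of_mem_closedBall (hsub hx), one_mul]
  · simp [image_eq_zero_of_notMem_tsupport hx]

end Lipschitz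

theorem hasDerivAt_mul_abs_rpow {p : ℝ} (hp : 0 ≤ p) (t : ℝ) :
    HasDerivAt (fun t : ℝ => t * |t| ^ p) ((p + 1) * |t| ^ p) t := by
  rcases hp.eq_or_lt with rfl | hp
  · simpa using hasDerivAt_id' t
  rcases eq_or_ne t 0 with rfl | ht
  · rw [hasDerivAt_iff_tendsto_slope_zero]
    have hc : Continuous fun t : ℝ => |t| ^ p := continuous_abs.rpow_const fun _ => .inr hp.le
    have := (hc.tendsto 0).mono_left (nhdsWithin_le_nhds (s := {0}ᶜ))
    simp only [abs_zero, Real.zero_rpow hp.ne', mul_zero] at this ⊢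
    refine this.congr' ?_
    filter_upwards [self_mem_nhdsWithin] with s hs
    have : s ≠ 0 := hs
    simp [this]
  · have h1 := (hasDerivAt_id t).mul ((hasDerivAt_abs ht).rpow_const (p := p) (.inl (abs_ne_zero.2 ht)))
    refine h1.congr_deriv ?_
    have h2 : |t| ^ p = |t| ^ (p - 1) * |t| := by
      rw [← Real.rpow_add_one (abs_ne_zero.2 ht)]; simp
    have h3 : t * (SignType.sign t : ℝ) = |t| := self_mul_sign t
    simp only [id, one_mul]
    linear_combination p * |t| ^ (p - 1) * h3 - p * h2

theorem contDiff_mul_abs_rpow {p : ℝ} (hp : 0 ≤ p) :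
    ContDiff ℝ 1 fun t : ℝ => t * |t| ^ p := by
  rw [contDiff_one_iff_deriv]
  refine ⟨fun t => (hasDerivAt_mul_abs_rpow hp t).differentiableAt, ?_⟩
  rw [funext fun t => (hasDerivAt_mul_abs_rpow hp t).deriv]
  exact continuous_const.mul (continuous_abs.rpow_const fun _ => .inr hp)

theorem HasGradientAt.fun_mul {E : Type*} [NormedAddCommGroup E] [InnerProductSpace ℝ E]
    [CompleteSpace E] {f g : E → ℝ} {f' g' x : E} (hf : HasGradientAt f f' x)
    (hg : HasGradientAt g g' x) :
    HasGradientAt (fun y => f y * g y) (f x • g' + g x • f') x := by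
  have := hf.hasFDerivAt.mul hg.hasFDerivAt
  rw [hasGradientAt_iff_hasFDerivAt]
  exact this.congr_fderiv (by simp)

theorem HasDerivAt.comp_hasGradientAt {E : Type*} [NormedAddCommGroup E] [InnerProductSpace ℝ E]
    [CompleteSpace E] {φ : ℝ → ℝ} {φ' : ℝ} {f : E → ℝ} {f' x : E} (hφ : HasDerivAt φ φ' (f x))
    (hf : HasGradientAt f f' x) :
    HasGradientAt (fun y => φ (f y)) (φ' • f') x := by
  have := hφ.comp_hasFDerivAt x hf.hasFDerivAt
  rw [hasGradientAt_iff_hasFDerivAt]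
  exact this.congr_fderiv (by simp)

section Integrability

variable {d : ℕ} {μ : Measure (EuclideanSpace ℝ (Fin d))}

theorem measurable_gradient (u : EuclideanSpace ℝ (Fin d) → ℝ) : Measurable (gradient u) :=
  (InnerProductSpace.toDual ℝ _).symm.continuous.measurable.comp (measurable_fderiv ℝ u)

theorem integrable_inner_gradient {u : EuclideanSpace ℝ (Fin d) → ℝ}
    (hu : ∃ K, LipschitzWith K u)
    {V : EuclideanSpace ℝ (Fin d) → EuclideanSpace ℝ (Fin d)}
    (hV : IntegrableOn V (tsupport u) μ) :
    Integrable (fun x => ⟪V x, gradient u x⟫) μ := by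
  obtain ⟨K, hK⟩ := hu
  rw [← integrableOn_iff_integrable_of_support_subset (s := tsupport u)]
  · refine (hV.norm.mul_const (K : ℝ)).mono'
      (hV.aestronglyMeasurable.inner (measurable_gradient u).aestronglyMeasurable)
      (.of_forall fun x => ?_)
    refine (norm_inner_le_norm _ _).trans ?_
    gcongr
    rw [gradient, LinearIsometryEquiv.norm_map]
    exact norm_fderiv_le_of_lipschitz ℝ hK
  · intro x hx
    refine support_fderiv_subset ℝ fun h0 => hx ?_
    simp [gradient, h0]

end Integrability

theorem ofReal_integral_le_lintegral_ofReal {X : Type*} [MeasurableSpace X] {μ : Measure X}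
    {f : X → ℝ} (hf : Integrable f μ) :
    ENNReal.ofReal (∫ x, f x ∂μ) ≤ ∫⁻ x, ENNReal.ofReal (f x) ∂μ := by
  refine ENNReal.ofReal_le_of_le_toReal ?_
  rw [integral_eq_lintegral_pos_part_sub_lintegral_neg_part hf]
  exact sub_le_self _ ENNReal.toReal_nonneg

theorem rpow_abs_eq_sq_mul {q : ℝ} (hq : 2 ≤ q) (t : ℝ) : |t| ^ q = t ^ 2 * |t| ^ (q - 2) := by
  rw [← sq_abs, ← Real.rpow_two, ← Real.rpow_add_of_nonneg (abs_nonneg t) two_pos.le (by linarith)]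
  congr 1
  ring

/-- Pointwise form of the estimate: the integrand of the weak identity tested with
`u = w² h |h|^(q-2)`, corrected by the divergence-free term tested with `u h`. -/
theorem weak_integrand_le {d : ℕ} (hd : 0 < d) {A C : Matrix (Fin d) (Fin d) ℝ}
    (hAsymm : A.IsSymm) (hApos : A.PosDef) (hCanti : C.transpose = -C) {q : ℝ} (hq : 2 ≤ q)
    (B : EuclideanSpace ℝ (Fin d)) {w h : EuclideanSpace ℝ (Fin d) → ℝ}
    {x : EuclideanSpace ℝ (Fin d)} (hw : DifferentiableAt ℝ w x) (hh : DifferentiableAt ℝ h x) :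
    -(1 / 2) * mdot (A + C)
          (gradient (fun y => w y * (w y * (h y * |h y| ^ (q - 2)))) x) (gradient h x)
        - ⟪B, gradient (fun y => w y * (w y * (h y * |h y| ^ (q - 2)))) x⟫ * h x
        + (q - 1) / q * ⟪B, gradient (fun y => w y * (w y * (h y * |h y| ^ (q - 2))) * h y) x⟫
      ≤ 2 / (q - 1) * (mdot A (gradient w x) (gradient w x) * |h x| ^ q)
        + 2 / (q - 1) * ((d : ℝ) ^ 2 * matSup C ^ 2 * (PhiA A)⁻¹
              * ‖gradient w x‖ ^ 2 * |h x| ^ q)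
        + 2 / q * (|⟪B, gradient w x⟫| * |w x| * |h x| ^ q) := by
  have hφ := (hasDerivAt_mul_abs_rpow (sub_nonneg.2 hq) (h x)).comp_hasGradientAt hh.hasGradientAt
  have hu := hw.hasGradientAt.fun_mul (hw.hasGradientAt.fun_mul hφ)
  have hf := hu.fun_mul hh.hasGradientAt
  rw [hf.gradient, hu.gradient, rpow_abs_eq_sq_mul hq]
  have hc : 0 < q - 1 := by linarith
  have hA := neg_mul_mdot_le_of_posDef (gradient h x) hAsymm hApos hc (w x) (h x)
    (v := gradient w x)
  have hC := neg_mul_mdot_le (gradient h x) hd hApos C hc (w x) (h x) (v := gradient w x)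
  have hB : -(w x * ⟪B, gradient w x⟫) ≤ |⟪B, gradient w x⟫| * |w x| := by
    rw [← abs_mul, mul_comm]
    exact neg_le_abs _
  have hAA : 0 ≤ mdot A (gradient w x) (gradient w x) := mdot_self_nonneg hApos
  have hT : 0 ≤ (d : ℝ) ^ 2 * matSup C ^ 2 * (PhiA A)⁻¹ * ‖gradient w x‖ ^ 2 := by
    have := PhiA_pos hd hApos
    positivity
  have hCC : mdot C (gradient h x) (gradient h x) = 0 := mdot_self_eq_zero_of_antisymm hCanti
  simp only [mdot_matrix_add, mdot_add_left, mdot_smul_left, inner_add_right,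
    real_inner_smul_right, hCC]
  have hP : 0 ≤ |h x| ^ (q - 2) := by positivity
  have hq0 : 0 < q := by linarith
  generalize |h x| ^ (q - 2) = P at *
  generalize mdot A (gradient w x) (gradient w x) = a at *
  generalize (d : ℝ) ^ 2 * matSup C ^ 2 * (PhiA A)⁻¹ * ‖gradient w x‖ ^ 2 = b at *
  have hAC := mul_le_mul_of_nonneg_left (add_le_add hA hC) hP
  refine le_of_eq_of_le (b := P * (-(w x * h x * mdot A (gradient w x) (gradient h x)) +
      -(w x * h x * mdot C (gradient w x) (gradient h x))) -
      (q - 1) / 2 * P * w x ^ 2 * mdot A (gradient h x) (gradient h x) +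
      2 / q * (h x ^ 2 * P) * -(w x * ⟪B, gradient w x⟫)) (by field_simp; ring) ?_
  calc _ ≤ P * ((q - 1) / 4 * (w x ^ 2 * mdot A (gradient h x) (gradient h x)) +
        1 / (q - 1) * (h x ^ 2 * a) +
        ((q - 1) / 4 * (w x ^ 2 * mdot A (gradient h x) (gradient h x)) +
        1 / (q - 1) * (h x ^ 2 * b))) -
        (q - 1) / 2 * P * w x ^ 2 * mdot A (gradient h x) (gradient h x) +
        2 / q * (h x ^ 2 * P) * (|⟪B, gradient w x⟫| * |w x|) := by gcongr
    _ = 1 / (q - 1) * (a * (h x ^ 2 * P)) + 1 / (q - 1) * (b * (h x ^ 2 * P)) +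
        2 / q * (|⟪B, gradient w x⟫| * |w x| * (h x ^ 2 * P)) := by ring
    _ ≤ _ := by
        gcongr <;> norm_num

/-- The estimate (3.9) from the proof of Theorem 3.3: for `q ∈ [2,∞)`, a `C¹` function `h`
with `∫ |h|^q dμ < ∞` satisfying the weak resolvent identity and any compactly supported
Lipschitz `w`,
`∫ w²|h|^q dμ ≤ (2/(q-1)) ∫ ⟨A∇w,∇w⟩ |h|^q dμ
  + (2/(q-1)) ∫ d² |C|_∞² Φ_A⁻¹ ‖∇w‖² |h|^q dμ + (2/q) ∫ |⟨B̄,∇w⟩| |w| |h|^q dμ`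
in `[0,∞]`. -/
theorem stmt5 {d : ℕ} (hd : 2 ≤ d)
    (ρ : EuclideanSpace ℝ (Fin d) → ℝ) (hρc : Continuous ρ) (hρ : ∀ x, 0 < ρ x)
    (μ : Measure (EuclideanSpace ℝ (Fin d)))
    (hμ : μ = volume.withDensity fun x => ENNReal.ofReal (ρ x))
    (A C : EuclideanSpace ℝ (Fin d) → Matrix (Fin d) (Fin d) ℝ)
    (hAc : ∀ i j, Continuous fun x => A x i j)
    (hAsymm : ∀ x, (A x).IsSymm) (hApos : ∀ x, (A x).PosDef)
    (hCc : ∀ i j, Continuous fun x => C x i j)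
    (hCanti : ∀ x, (C x).transpose = -(C x))
    (Bb : EuclideanSpace ℝ (Fin d) → EuclideanSpace ℝ (Fin d))
    (hBmeas : Measurable Bb)
    (hBloc : LocallyIntegrable (fun x => ‖Bb x‖) μ)
    (hBdiv : ∀ f : EuclideanSpace ℝ (Fin d) → ℝ, (∃ K, LipschitzWith K f) →
      HasCompactSupport f → ∫ x, ⟪Bb x, gradient f x⟫ ∂μ = 0)
    (q : ℝ) (hq : 2 ≤ q)
    (h : EuclideanSpace ℝ (Fin d) → ℝ) (hh1 : ContDiff ℝ 1 h)
    (hhq : Integrable (fun x => |h x| ^ q) μ)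
    (hres : WeakResolvent μ A C Bb h) :
    ∀ w : EuclideanSpace ℝ (Fin d) → ℝ,
      (∃ K, LipschitzWith K w) → HasCompactSupport w →
      (∫⁻ x, ENNReal.ofReal (w x ^ 2 * |h x| ^ q) ∂μ)
      ≤ ENNReal.ofReal (2 / (q - 1)) *
          (∫⁻ x, ENNReal.ofReal (mdot (A x) (gradient w x) (gradient w x) * |h x| ^ q) ∂μ)
        + ENNReal.ofReal (2 / (q - 1)) *
          (∫⁻ x, ENNReal.ofReal ((d : ℝ) ^ 2 * matSup (C x) ^ 2 * (PhiA (A x))⁻¹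
              * ‖gradient w x‖ ^ 2 * |h x| ^ q) ∂μ)
        + ENNReal.ofReal (2 / q) *
          (∫⁻ x, ENNReal.ofReal (|⟪Bb x, gradient w x⟫| * |w x| * |h x| ^ q) ∂μ) := by
  intro w hw hws
  have hμac : μ ≪ volume := hμ ▸ withDensity_absolutelyContinuous _ _
  have : IsLocallyFiniteMeasure μ := hμ ▸ IsLocallyFiniteMeasure.withDensity_ofReal hρc
  have hφ : ContDiff ℝ 1 fun x => h x * |h x| ^ (q - 2) :=
    (contDiff_mul_abs_rpow (sub_nonneg.2 hq)).comp hh1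
  have hgh : Continuous (gradient h) :=
    (InnerProductSpace.toDual ℝ _).symm.continuous.comp (hh1.continuous_fderiv one_ne_zero)
  set u : EuclideanSpace ℝ (Fin d) → ℝ := fun x => w x * (w x * (h x * |h x| ^ (q - 2))) with hu_def
  have hu : ∃ K, LipschitzWith K u :=
    exists_lipschitzWith_mul hw hws (exists_lipschitzWith_mul_contDiff hw hws hφ) hws.mul_right
  have hus : HasCompactSupport u := hws.mul_right
  have hf : ∃ K, LipschitzWith K fun x => u x * h x := exists_lipschitzWith_mul_contDiff hu hus hh1
  have hfs : HasCompactSupport fun x => u x * h x := hus.mul_right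
  have hB {K : Set (EuclideanSpace ℝ (Fin d))} (hK : IsCompact K) : IntegrableOn Bb K μ :=
    (integrable_norm_iff hBmeas.aestronglyMeasurable).1 (hBloc.integrableOn_isCompact hK)
  have i₁ : Integrable (fun x => mdot (A x + C x) (gradient u x) (gradient h x)) μ := by
    simp only [mdot_eq_inner]
    refine integrable_inner_gradient hu (Continuous.locallyIntegrable ?_ |>.integrableOn_isCompact hus)
    refine (PiLp.continuous_toLp 2 _).comp (Continuous.matrix_mulVec ?_ ?_)
    · exact continuous_matrix fun i j => (hAc j i).add (hCc j i)
    · exact (PiLp.continuous_ofLp 2 _).comp hgh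
  have i₂ : Integrable (fun x => ⟪Bb x, gradient u x⟫ * h x) μ := by
    simpa only [real_inner_smul_left, mul_comm] using integrable_inner_gradient hu
      ((hB hus).continuousOn_smul hh1.continuous.continuousOn hus)
  have i₃ := integrable_inner_gradient hf (hB hfs)
  have i₀ : Integrable (fun x => u x * h x) μ := by
    obtain ⟨K, hK⟩ := hf
    exact hK.continuous.integrable_of_hasCompactSupport hfs
  have hsq (x) : u x * h x = w x ^ 2 * |h x| ^ q := by
    rw [rpow_abs_eq_sq_mul hq]
    simp only [hu_def]
    ring
  have i₁₂ : Integrable (fun x => -(1 / 2) * mdot (A x + C x) (gradient u x) (gradient h x)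
      - ⟪Bb x, gradient u x⟫ * h x) μ := (i₁.const_mul _).sub i₂
  have hint : ∫ x, u x * h x ∂μ = ∫ x, -(1 / 2) * mdot (A x + C x) (gradient u x) (gradient h x)
      - ⟪Bb x, gradient u x⟫ * h x
      + (q - 1) / q * ⟪Bb x, gradient (fun y => u y * h y) x⟫ ∂μ := by
    rw [integral_add i₁₂ (i₃.const_mul _),
      integral_sub (i₁.const_mul _) i₂, integral_const_mul, integral_const_mul, hBdiv _ hf hfs]
    linarith [hres u hu hus]
  have hwm : Measurable w := by
    obtain ⟨K, hK⟩ := hw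
    exact hK.continuous.measurable
  have hgw := measurable_gradient w
  have hhm : Measurable fun x => |h x| ^ q :=
    (hh1.continuous.abs.rpow_const fun _ => .inr (by linarith)).measurable
  have m₁ : Measurable fun x => mdot (A x) (gradient w x) (gradient w x) * |h x| ^ q := by
    have hA i j := (hAc i j).measurable
    have hg (i : Fin d) : Measurable fun x => gradient w x i := by fun_prop
    unfold mdot
    fun_prop
  have m₃ : Measurable fun x => |⟪Bb x, gradient w x⟫| * |w x| * |h x| ^ q :=
    ((hBmeas.inner hgw).abs.mul hwm.abs).mul hhm
  have hdiff : ∀ᵐ x ∂μ, DifferentiableAt ℝ w x := by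
    obtain ⟨K, hK⟩ := hw
    exact hμac.ae_le hK.ae_differentiableAt
  have hc₁ : 0 ≤ 2 / (q - 1) := div_nonneg two_pos.le (by linarith)
  have hc₂ : 0 ≤ 2 / q := div_nonneg two_pos.le (by linarith)
  simp only [← hsq]
  rw [← ofReal_integral_eq_lintegral_ofReal i₀ (.of_forall fun x => by
    simp only [hsq, Pi.zero_apply]; positivity), hint,
    ← lintegral_const_mul' _ _ ENNReal.ofReal_ne_top, ← lintegral_const_mul' _ _ ENNReal.ofReal_ne_top,
    ← lintegral_const_mul' _ _ ENNReal.ofReal_ne_top,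
    ← lintegral_add_left (m₁.ennreal_ofReal.const_mul _),
    ← lintegral_add_right _ (m₃.ennreal_ofReal.const_mul _)]
  refine (ofReal_integral_le_lintegral_ofReal
    (i₁₂.add (i₃.const_mul _))).trans (lintegral_mono_ae ?_)
  filter_upwards [hdiff] with x hx
  rw [← ENNReal.ofReal_mul hc₁, ← ENNReal.ofReal_mul hc₁, ← ENNReal.ofReal_mul hc₂]
  refine (ENNReal.ofReal_le_ofReal (weak_integrand_le (by lia) (hAsymm x) (hApos x) (hCanti x) hq
    (Bb x) hx (hh1.differentiable one_ne_zero x))).trans ?_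
  refine ENNReal.ofReal_add_le.trans ?_
  gcongr
  exact ENNReal.ofReal_add_le
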